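/- arXiv:2505.23152 — 2 statements merged into one kernel-verified Lean document; each statement's English description precedes it below -/
import Mathlib

section
/- Let n ≥ 2, σ ∈ (0,1], and let A = σI + (1−σ)𝟙𝟙ᵀ be the n×n permutation-invariant matrix. Let Γ = tril(A) and C = I − Γ⁻¹A. Then every entry of the matrix CᵀC is nonnegative. -/
open Matrix

/-- Lower-triangular part (including the diagonal) of a matrix. -/
def tril (n : ℕ) (M : Matrix (Fin n) (Fin n) ℝ) : Matrix (Fin n) (Fin n) ℝ :=
  Matrix.of fun i j => if j ≤ i then M i j else 0

/-- The entries of `I - Γ⁻¹A` divided by `1 - σ`, indexed by natural numbers. -/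
def gsEntry (σ : ℝ) (i j : ℕ) : ℝ :=
  if i < j then -σ ^ i else σ ^ (i - j) * (1 - σ ^ j)

theorem gsEntry_forward_substitution (σ : ℝ) (i j : ℕ) :
    (1 - σ) * ∑ k ∈ Finset.range i, gsEntry σ k j + gsEntry σ i j = if i < j then -1 else 0 := by
  induction i with
  | zero =>
    rcases Nat.eq_zero_or_pos j with rfl | hj
    · simp [gsEntry]
    · simp [gsEntry, hj]
  | succ i ih =>
    have step : gsEntry σ (i + 1) j - σ * gsEntry σ i j
        = (if i + 1 < j then -1 else 0) - (if i < j then -1 else 0) := by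
      unfold gsEntry
      rcases lt_trichotomy (i + 1) j with h | h | h
      · rw [if_pos h, if_pos (by omega), if_pos h, if_pos (by omega)]
        ring
      · subst h
        simp
        ring
      · obtain ⟨d, rfl⟩ : ∃ d, i = j + d := ⟨i - j, by omega⟩
        rw [if_neg (by omega), if_neg (by omega), if_neg (by omega), if_neg (by omega),
          show j + d + 1 - j = d + 1 by omega, show j + d - j = d by omega]
        ring
    rw [Finset.sum_range_succ]
    linear_combination ih + step

theorem sum_gsEntry_mul_range_left (σ : ℝ) {j k m : ℕ} (hjk : j ≤ k) (hm : m ≤ j) :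
    (1 - σ ^ 2) * ∑ i ∈ Finset.range m, gsEntry σ i j * gsEntry σ i k = 1 - σ ^ (2 * m) := by
  induction m with
  | zero => simp
  | succ m ih =>
    have h := ih (by omega)
    rw [Finset.sum_range_succ, mul_add, h, gsEntry, gsEntry, if_pos (by omega), if_pos (by omega)]
    ring

theorem sum_gsEntry_mul_range_add (σ : ℝ) {j k d : ℕ} (hd : j + d ≤ k) :
    (1 - σ ^ 2) * ∑ i ∈ Finset.range (j + d), gsEntry σ i j * gsEntry σ i k
      = (1 - σ ^ j) * (1 + σ ^ j * σ ^ (2 * d)) := by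
  induction d with
  | zero =>
    rw [add_zero, sum_gsEntry_mul_range_left σ (by omega) le_rfl]
    ring
  | succ d ih =>
    have h := ih (by omega)
    rw [← add_assoc, Finset.sum_range_succ, mul_add, h, gsEntry, gsEntry, if_neg (by omega),
      if_pos (by omega), show j + d - j = d by omega]
    ring

theorem sum_gsEntry_mul_nonneg {σ : ℝ} (hσ0 : 0 < σ) (hσ1 : σ < 1) {j k n : ℕ} (hjk : j ≤ k)
    (hk : k ≤ n) : 0 ≤ ∑ i ∈ Finset.range n, gsEntry σ i j * gsEntry σ i k := by
  have hpow (m : ℕ) : 0 ≤ 1 - σ ^ m := sub_nonneg.2 (pow_le_one₀ hσ0.le hσ1.le)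
  rw [← Finset.sum_range_add_sum_Ico _ hk]
  refine add_nonneg ?_ (Finset.sum_nonneg fun i hi => ?_)
  · obtain ⟨d, rfl⟩ := Nat.exists_eq_add_of_le hjk
    have hpos : 0 < 1 - σ ^ 2 := by nlinarith
    refine nonneg_of_mul_nonneg_right ?_ hpos
    rw [sum_gsEntry_mul_range_add σ le_rfl]
    exact mul_nonneg (hpow j) (by positivity)
  · have := (Finset.mem_Ico.1 hi).1
    rw [gsEntry, gsEntry, if_neg (by omega), if_neg (by omega)]
    exact mul_nonneg (mul_nonneg (by positivity) (hpow j)) (mul_nonneg (by positivity) (hpow k))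

theorem one_sub_tril_inv_mul (n : ℕ) (σ : ℝ) {A : Matrix (Fin n) (Fin n) ℝ}
    (hA : A = σ • (1 : Matrix (Fin n) (Fin n) ℝ)
      + (1 - σ) • Matrix.of (fun _ _ : Fin n => (1 : ℝ))) :
    1 - (tril n A)⁻¹ * A = Matrix.of fun i j : Fin n => (1 - σ) * gsEntry σ i j := by
  have hentry (i j : Fin n) : A i j = if i = j then 1 else 1 - σ := by
    by_cases h : i = j <;> simp [hA, h]
  have hdet : IsUnit (tril n A).det := by
    rw [Matrix.det_of_isLowerTriangular]
    · simp [tril, hentry]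
    · intro i j hij
      have : ¬ j ≤ i := not_le.2 hij
      simp [tril, this]
  have hmul : tril n A * (Matrix.of fun i j : Fin n => (1 - σ) * gsEntry σ i j)
      = tril n A - A := by
    ext i j
    have hsum : ∑ k : Fin n, tril n A i k * ((1 - σ) * gsEntry σ k j)
        = (1 - σ) * ((1 - σ) * ∑ k ∈ Finset.range i, gsEntry σ k j + gsEntry σ i j) := by
      have hterm (k : Fin n) : tril n A i k * ((1 - σ) * gsEntry σ k j)
          = (fun k : ℕ => (if k < i then (1 - σ) * ((1 - σ) * gsEntry σ k j) else 0)
            + if k = i then (1 - σ) * gsEntry σ k j else 0) k := by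
        rcases lt_trichotomy k i with h | h | h
        · simp [tril, hentry, h, h.le, h.ne, h.ne', Fin.val_inj]
        · simp [tril, hentry, h]
        · simp [tril, h.not_ge, h.le, h.ne', Fin.val_inj]
      rw [Finset.sum_congr rfl fun k _ => hterm k, Fin.sum_univ_eq_sum_range (fun k : ℕ =>
          (if k < i then (1 - σ) * ((1 - σ) * gsEntry σ k j) else 0)
            + if k = i then (1 - σ) * gsEntry σ k j else 0),
        Finset.sum_add_distrib, Finset.sum_ite_eq', if_pos (Finset.mem_range.2 i.2),
        ← Finset.sum_filter,
        show (Finset.range n).filter (· < (i : ℕ)) = Finset.range i by ext; simp; omega,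
        ← Finset.mul_sum, ← Finset.mul_sum]
      ring
    rw [Matrix.mul_apply]
    simp only [Matrix.of_apply]
    rw [hsum, gsEntry_forward_substitution, Matrix.sub_apply]
    by_cases h : i < j
    · simp [tril, hentry, h, h.not_ge, h.ne]
    · simp [tril, h, not_lt.1 h]
  rw [← Matrix.nonsing_inv_mul_cancel_left _ (Matrix.of _) hdet, hmul, Matrix.mul_sub,
    Matrix.nonsing_inv_mul _ hdet]

/-- For `A = σI + (1-σ)𝟙𝟙ᵀ`, `Γ = tril A`, `C = I - Γ⁻¹A`, every entry of
`CᵀC` is nonnegative. -/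
theorem entries_CtC_nonneg (n : ℕ) (hn : 2 ≤ n) (σ : ℝ) (hσ0 : 0 < σ) (hσ1 : σ ≤ 1) :
    let A : Matrix (Fin n) (Fin n) ℝ :=
      σ • (1 : Matrix (Fin n) (Fin n) ℝ) + (1 - σ) • Matrix.of (fun _ _ : Fin n => (1 : ℝ))
    let C : Matrix (Fin n) (Fin n) ℝ := 1 - (tril n A)⁻¹ * A
    ∀ i j : Fin n, 0 ≤ (Cᵀ * C) i j := by
  intro A C i j
  have hC : C = Matrix.of fun i j : Fin n => (1 - σ) * gsEntry σ i j :=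
    one_sub_tril_inv_mul n σ rfl
  have hprod : (Cᵀ * C) i j
      = (1 - σ) ^ 2 * ∑ k ∈ Finset.range n, gsEntry σ k i * gsEntry σ k j := by
    rw [hC, Matrix.mul_apply, ← Fin.sum_univ_eq_sum_range
      (fun k => gsEntry σ k i * gsEntry σ k j), Finset.mul_sum]
    refine Finset.sum_congr rfl fun k _ => ?_
    simp only [Matrix.transpose_apply, Matrix.of_apply]
    ring
  rw [hprod]
  rcases hσ1.eq_or_lt with rfl | hlt
  · simp
  · refine mul_nonneg (sq_nonneg _) ?_
    rcases le_total (i : ℕ) j with h | h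
    · exact sum_gsEntry_mul_nonneg hσ0 hlt h j.2.le
    · simp_rw [mul_comm (gsEntry σ _ i)]
      exact sum_gsEntry_mul_nonneg hσ0 hlt h i.2.le
end

section
/- Let n ≥ 2, let k be an integer with 2 ≤ k ≤ n, let σ ∈ (0,1], and let A be the n×n block-diagonal matrix A = diag{ σI_k + (1−σ)𝟙_k 𝟙_kᵀ, I_{n−k} } (so A_{ii} = 1, A_{ij} = 1−σ when i ≠ j and both i, j ≤ k, and A_{ij} = 0 otherwise). Let p be any permutation of {1,…,n}, and let q be any permutation of {1,…,n} such that q(j) = j for all j > k, q maps {1,…,k} onto itself, and for all i, j ∈ {1,…,k}: q⁻¹(i) ≤ q⁻¹(j) if and only if p⁻¹(i) ≤ p⁻¹(j). Then, with P and Q the permutation matrices of p and q, P · tril(Pᵀ A P) · Pᵀ = Q · tril(Qᵀ A Q) · Qᵀ. -/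
open Matrix

/-- Permutation matrix of `p`: `P e_j = e_{p j}`. -/
def permMat (n : ℕ) (p : Equiv.Perm (Fin n)) : Matrix (Fin n) (Fin n) ℝ :=
  Matrix.of fun i j => if i = p j then 1 else 0

theorem permMat_mul_mul_transpose_apply (n : ℕ) (p : Equiv.Perm (Fin n))
    (M : Matrix (Fin n) (Fin n) ℝ) (i j : Fin n) :
    (permMat n p * M * (permMat n p)ᵀ) i j = M (p.symm i) (p.symm j) := by
  simp [permMat, Matrix.mul_apply, ← Equiv.symm_apply_eq]

theorem permMat_transpose_mul_mul_apply (n : ℕ) (p : Equiv.Perm (Fin n))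
    (M : Matrix (Fin n) (Fin n) ℝ) (i j : Fin n) :
    ((permMat n p)ᵀ * M * permMat n p) i j = M (p i) (p j) := by
  simp [permMat, Matrix.mul_apply]

theorem permMat_mul_tril_mul_transpose_apply (n : ℕ) (p : Equiv.Perm (Fin n))
    (M : Matrix (Fin n) (Fin n) ℝ) (i j : Fin n) :
    (permMat n p * tril n ((permMat n p)ᵀ * M * permMat n p) * (permMat n p)ᵀ) i j =
      if p.symm j ≤ p.symm i then M i j else 0 := by
  simp [permMat_mul_mul_transpose_apply, tril, permMat_transpose_mul_mul_apply]

/-- Lemma B.4: for the block-diagonal matrix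
`A = diag{σI_k + (1-σ)𝟙𝟙ᵀ, I_{n-k}}` and a permutation `q` fixing indices above
`k`, mapping `{1,…,k}` onto itself, and ordering `{1,…,k}` the same way `p` does,
one has `P Γ_P Pᵀ = Q Γ_Q Qᵀ`. -/
theorem block_perm_tril_eq (n k : ℕ) (hn : 2 ≤ n) (hk2 : 2 ≤ k) (hkn : k ≤ n)
    (σ : ℝ) (hσ0 : 0 < σ) (hσ1 : σ ≤ 1)
    (p q : Equiv.Perm (Fin n))
    (hqfix : ∀ j : Fin n, k ≤ (j : ℕ) → q j = j)
    (hqblock : ∀ j : Fin n, (j : ℕ) < k ↔ ((q j : Fin n) : ℕ) < k)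
    (hqorder : ∀ i j : Fin n, (i : ℕ) < k → (j : ℕ) < k →
      (q.symm i ≤ q.symm j ↔ p.symm i ≤ p.symm j)) :
    let A : Matrix (Fin n) (Fin n) ℝ := Matrix.of fun i j =>
      if i = j then 1 else if (i : ℕ) < k ∧ (j : ℕ) < k then 1 - σ else 0
    permMat n p * tril n ((permMat n p)ᵀ * A * permMat n p) * (permMat n p)ᵀ =
      permMat n q * tril n ((permMat n q)ᵀ * A * permMat n q) * (permMat n q)ᵀ := by
  intro A
  ext i j
  rw [permMat_mul_tril_mul_transpose_apply, permMat_mul_tril_mul_transpose_apply]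
  by_cases hij : i = j
  · simp [hij]
  by_cases hk : (i : ℕ) < k ∧ (j : ℕ) < k
  · simp only [hqorder j i hk.2 hk.1]
  · have hA : A i j = 0 := by simp only [A, Matrix.of_apply, if_neg hij, if_neg hk]
    simp only [hA, ite_self]
end
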